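/- Suppose 0 < α < minᵢ λᵢ. Then f_α(0) = f_α(α). -/

import Mathlib

open Matrix

/-- `W(δ) = U · diag(√(λᵢ − δ))`. -/
noncomputable def Wmat {M P : ℕ} (U : Matrix (Fin M) (Fin P) ℝ) (lam : Fin P → ℝ)
    (δ : ℝ) : Matrix (Fin M) (Fin P) ℝ :=
  U * Matrix.diagonal (fun i => Real.sqrt (lam i - δ))

/-- `ẑ(δ) = L⁻¹ · diag(√(λᵢ − δ)) · Uᵀ x`. -/
noncomputable def zhat {M P : ℕ} (U : Matrix (Fin M) (Fin P) ℝ) (lam : Fin P → ℝ)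
    (δ : ℝ) (x : Fin M → ℝ) : Fin P → ℝ :=
  ((Matrix.diagonal lam)⁻¹ * Matrix.diagonal (fun i => Real.sqrt (lam i - δ)) * Uᵀ).mulVec x

/-- Squared Euclidean norm on `ℝ^M`. -/
noncomputable def enormSq {M : ℕ} (v : Fin M → ℝ) : ℝ :=
  ‖(EuclideanSpace.equiv (Fin M) ℝ).symm v‖ ^ 2

/-- `f_α(δ) = (1/2)·(ẑ(δ)ᵀẑ(δ) + (1/α)·‖x − W(δ)ẑ(δ)‖²)`. -/
noncomputable def fA {M P : ℕ} (U : Matrix (Fin M) (Fin P) ℝ) (lam : Fin P → ℝ)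
    (x : Fin M → ℝ) (α δ : ℝ) : ℝ :=
  (1 / 2) * (zhat U lam δ x ⬝ᵥ zhat U lam δ x +
    (1 / α) * enormSq (x - (Wmat U lam δ).mulVec (zhat U lam δ x)))

lemma enormSq_eq_dotProduct {M : ℕ} (v : Fin M → ℝ) : enormSq v = v ⬝ᵥ v := by
  simp [enormSq, EuclideanSpace.norm_sq_eq, dotProduct, ← sq]

lemma zhat_apply {M P : ℕ} (U : Matrix (Fin M) (Fin P) ℝ) {lam : Fin P → ℝ}
    (hlam : ∀ i, lam i ≠ 0) (δ : ℝ) (x : Fin M → ℝ) (i : Fin P) :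
    zhat U lam δ x i = Real.sqrt (lam i - δ) / lam i * (Uᵀ *ᵥ x) i := by
  have hinv : (diagonal lam)⁻¹ = diagonal (fun i => (lam i)⁻¹) := by
    apply Matrix.inv_eq_right_inv
    simp [hlam]
  rw [zhat, hinv, diagonal_mul_diagonal, ← mulVec_mulVec, mulVec_diagonal]
  ring

/-- The residual of a vector after subtracting a combination of orthonormal columns. -/
lemma enormSq_sub_mulVec {M P : ℕ} {U : Matrix (Fin M) (Fin P) ℝ} (hU : Uᵀ * U = 1)
    (x : Fin M → ℝ) (w : Fin P → ℝ) :
    enormSq (x - U *ᵥ w) = x ⬝ᵥ x - 2 * (w ⬝ᵥ (Uᵀ *ᵥ x)) + w ⬝ᵥ w := by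
  have hcross : x ⬝ᵥ (U *ᵥ w) = w ⬝ᵥ (Uᵀ *ᵥ x) := by
    rw [dotProduct_mulVec, mulVec_transpose, dotProduct_comm]
  have hnorm : (U *ᵥ w) ⬝ᵥ (U *ᵥ w) = w ⬝ᵥ w := by
    rw [dotProduct_mulVec, ← mulVec_transpose, mulVec_mulVec, hU, one_mulVec]
  rw [enormSq_eq_dotProduct, sub_dotProduct, dotProduct_sub, dotProduct_sub, hnorm,
    dotProduct_comm (U *ᵥ w) x, hcross]
  ring

/-- Diagonalized form of `fA` in the coordinates `Uᵀ x`. -/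
lemma fA_eq_sum {M P : ℕ} {U : Matrix (Fin M) (Fin P) ℝ} (hU : Uᵀ * U = 1)
    {lam : Fin P → ℝ} (hlam : ∀ i, lam i ≠ 0) (x : Fin M → ℝ) (α : ℝ) {δ : ℝ}
    (hδ : ∀ i, δ ≤ lam i) :
    fA U lam x α δ = (1 / 2) * ((1 / α) * (x ⬝ᵥ x) +
      ∑ i, ((lam i - δ) / lam i ^ 2 + (1 / α) * (δ ^ 2 / lam i ^ 2 - 1)) *
        (Uᵀ *ᵥ x) i ^ 2) := by
  have hsq : ∀ i, Real.sqrt (lam i - δ) ^ 2 = lam i - δ := fun i =>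
    Real.sq_sqrt (sub_nonneg.2 (hδ i))
  rw [fA, Wmat, ← mulVec_mulVec, enormSq_sub_mulVec hU]
  generalize x ⬝ᵥ x = n, 1 / α = c
  simp only [dotProduct, mulVec_diagonal, zhat_apply U hlam]
  rw [sub_add, Finset.mul_sum, ← Finset.sum_sub_distrib, mul_sub, Finset.mul_sum,
    add_sub_left_comm, ← Finset.sum_sub_distrib]
  congr 2
  refine Finset.sum_congr rfl fun i _ => ?_
  have hz : Real.sqrt (lam i - δ) * (Real.sqrt (lam i - δ) / lam i * (Uᵀ *ᵥ x) i) =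
      (lam i - δ) / lam i * (Uᵀ *ᵥ x) i := by
    rw [← hsq i]
    ring_nf
    simp [hsq]
  have hi := hlam i
  rw [hz, ← sq (_ / _ * _), mul_pow, div_pow, hsq]
  field_simp
  ring

/-- `f_α(0) = f_α(α)`. -/
theorem fA_zero_eq_fA_alpha (M P : ℕ) (hM : 0 < M) (hP : 0 < P)
    (x : Fin M → ℝ)
    (U : Matrix (Fin M) (Fin P) ℝ)
    (hU : Uᵀ * U = (1 : Matrix (Fin P) (Fin P) ℝ))
    (lam : Fin P → ℝ) (hlam : ∀ i, 0 < lam i)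
    (α : ℝ) (hα : 0 < α) (hαlam : ∀ i, α < lam i) :
    fA U lam x α 0 = fA U lam x α α := by
  have hne : ∀ i, lam i ≠ 0 := fun i => (hlam i).ne'
  rw [fA_eq_sum hU hne x α fun i => (hlam i).le, fA_eq_sum hU hne x α fun i => (hαlam i).le]
  congr 2
  refine Finset.sum_congr rfl fun i _ => ?_
  have hi := hne i
  field_simp
  ring
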